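/- Every nontrivial element of finite order in the absolute Galois group of a field has order exactly 2. -/

import Mathlib

open Finset in
/-- Independence of characters, applied to the powers of an automorphism. -/
theorem AlgEquiv.exists_sum_mul_pow_apply_ne_zero {F C : Type*} [Field F] [Field C] [Algebra F C]
    (σ : C ≃ₐ[F] C) (d : ℕ → C) (hσ : 0 < orderOf σ) (hd : d 0 ≠ 0) :
    ∃ c, ∑ i ∈ range (orderOf σ), d i * (σ ^ i) c ≠ 0 := by
  by_contra! h
  let f : Fin (orderOf σ) → (C →* C) := fun i ↦ ((σ ^ (i : ℕ) : C ≃ₐ[F] C) : C →* C)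
  have hf : Function.Injective f := fun i j hij ↦ Fin.ext <|
    pow_injOn_Iio_orderOf (x := σ) i.2 j.2 (AlgEquiv.ext fun x ↦ DFunLike.congr_fun hij x)
  refine hd (Fintype.linearIndependent_iff.1 ((linearIndependent_monoidHom C C).comp f hf)
    (fun i ↦ d i) ?_ ⟨0, hσ⟩)
  ext x
  have := h x
  rw [← Fin.sum_univ_eq_sum_range (fun i ↦ d i * (σ ^ i) x)] at this
  simpa [f] using this

open Finset in
theorem Finset.sum_range_succ_shift {M : Type*} [AddCommGroup M] (g : ℕ → M) (n : ℕ)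
    (h : g n = g 0) : ∑ i ∈ range n, g (i + 1) = ∑ i ∈ range n, g i := by
  have := (sum_range_succ' g n).symm.trans (sum_range_succ g n)
  rwa [h, add_left_inj] at this

theorem AlgEquiv.apply_pow_apply {F C : Type*} [Field F] [Field C] [Algebra F C]
    (σ : C ≃ₐ[F] C) (i : ℕ) (c : C) : σ ((σ ^ i) c) = (σ ^ (i + 1)) c := by
  rw [pow_succ', AlgEquiv.mul_apply]

open Finset in
/-- A separably closed field of characteristic `p` has no automorphism of order `p`. -/
theorem IsSepClosed.orderOf_ne_char {F C : Type*} [Field F] [Field C] [Algebra F C]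
    [IsSepClosed C] (p : ℕ) [Fact p.Prime] [CharP C p] (σ : C ≃ₐ[F] C) : orderOf σ ≠ p := by
  intro hord
  have hp : p.Prime := Fact.out
  have hpow : σ ^ p = 1 := hord ▸ pow_orderOf_eq_one σ
  obtain ⟨c, hc⟩ := σ.exists_sum_mul_pow_apply_ne_zero (fun _ ↦ 1) (hord ▸ hp.pos) one_ne_zero
  simp only [one_mul, hord] at hc
  have trace_fixed (x : C) : σ (∑ i ∈ range p, (σ ^ i) x) = ∑ i ∈ range p, (σ ^ i) x := by
    simp only [map_sum, AlgEquiv.apply_pow_apply]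
    exact sum_range_succ_shift (fun i ↦ (σ ^ i) x) p (by simp [hpow])
  set t := ∑ i ∈ range p, (σ ^ i) c with ht
  have hσt : σ t = t := trace_fixed c
  -- Additive Hilbert 90 for the constant `1`.
  obtain ⟨θ, hθ⟩ : ∃ θ, σ θ = θ + 1 := by
    refine ⟨-(∑ i ∈ range p, (i : C) * (σ ^ i) c) / t, ?_⟩
    have h₁ := sum_range_succ_shift (fun i ↦ (i : C) * (σ ^ i) c) p (by simp)
    have h₂ := sum_range_succ_shift (fun i ↦ (σ ^ i) c) p (by simp [hpow])
    simp only [Nat.cast_add, Nat.cast_one, add_mul, one_mul, sum_add_distrib] at h₁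
    rw [map_div₀, map_neg, hσt]
    simp only [map_sum, map_mul, map_natCast, AlgEquiv.apply_pow_apply]
    rw [h₂, ← ht] at h₁
    rw [← h₁]
    field_simp
    ring
  set a := θ ^ p - θ with ha
  have hσa : σ a = a := by
    rw [ha, map_sub, map_pow, hθ, add_pow_char, one_pow]; ring
  have pow_fixed (z : C) (hz : σ z = z) (i : ℕ) : (σ ^ i) z = z := by
    induction i with
    | zero => simp
    | succ i ih => rw [pow_succ, AlgEquiv.mul_apply, hz, ih]
  obtain ⟨x, hx⟩ := exists_root_C_mul_X_pow_add_C_mul_X_add_C (n := p) 1 (-1) (-(a / t * c))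
    (CharP.cast_eq_zero C p) hp.two_le (neg_ne_zero.2 one_ne_zero)
  have hx' : x ^ p - x = a / t * c := by linear_combination hx
  set k := ∑ i ∈ range p, (σ ^ i) x with hk
  have hka : k ^ p - k = a := by
    rw [hk, sum_pow_char, ← sum_sub_distrib]
    have (i : ℕ) : ((σ ^ i) x) ^ p - (σ ^ i) x = a / t * (σ ^ i) c := by
      rw [← map_pow, ← map_sub, hx', map_mul, pow_fixed (a / t) (by rw [map_div₀, hσa, hσt])]
    simp only [this]
    rw [← mul_sum, ← ht, div_mul_cancel₀ _ hc]
  have hmem : θ - k ∈ (⊥ : Subfield C) := by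
    rw [Subfield.mem_bot_iff_pow_eq_self C p, sub_pow_char]
    linear_combination -hka - ha
  have hfix : σ (θ - k) = θ - k := by
    have : (⊥ : Subfield C) ≤ (σ : C →+* C).eqLocusField (RingHom.id C) := bot_le
    exact this hmem
  rw [map_sub, hθ, trace_fixed] at hfix
  exact one_ne_zero (α := C) (by linear_combination hfix)

open Finset in
/-- An automorphism of prime order of a separably closed field has order `2` and moves a
square root of `-1`. -/
theorem IsSepClosed.eq_two_of_orderOf_prime {F C : Type*} [Field F] [Field C] [Algebra F C]
    [IsSepClosed C] (q : ℕ) [Fact q.Prime] (σ : C ≃ₐ[F] C) (hord : orderOf σ = q) :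
    q = 2 ∧ ∃ ε : C, ε ^ 2 = -1 ∧ σ ε ≠ ε := by
  have hq : q.Prime := Fact.out
  have hqC : (q : C) ≠ 0 := fun h ↦ by
    have := (CharP.charP_iff_prime_eq_zero hq).2 h
    exact orderOf_ne_char q σ hord
  have : NeZero (q : C) := ⟨hqC⟩
  have : NeZero q := ⟨hq.ne_zero⟩
  have hpow : σ ^ q = 1 := hord ▸ pow_orderOf_eq_one σ
  obtain ⟨ζ, hζ⟩ : ∃ ζ : C, IsPrimitiveRoot ζ q :=
    HasEnoughRootsOfUnity.exists_primitiveRoot C q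
  have hζ0 : ζ ≠ 0 := hζ.ne_zero hq.ne_zero
  have hσζ : σ ζ = ζ := by
    obtain ⟨m, -, hm⟩ := hζ.eq_pow_of_pow_eq_one (ξ := σ ζ)
      (by rw [← map_pow, hζ.pow_eq_one, map_one])
    have hiter (i : ℕ) : (σ ^ i) ζ = ζ ^ m ^ i := by
      induction i with
      | zero => simp
      | succ i ih => rw [pow_succ, AlgEquiv.mul_apply, ← hm, map_pow, ih, ← pow_mul, pow_succ]
    have hfermat : m ^ q ≡ m [MOD q] := by
      rw [← ZMod.natCast_eq_natCast_iff, Nat.cast_pow, ZMod.pow_card]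
    have := hiter q
    have hm' : ζ ^ m ^ q = ζ ^ m := by
      rw [pow_eq_pow_mod _ hζ.pow_eq_one, hfermat, ← pow_eq_pow_mod _ hζ.pow_eq_one]
    rw [hpow, AlgEquiv.one_apply, hm', hm] at this
    exact this.symm
  have hroots (w : C) (hw : w ^ q = 1) : σ w = w := by
    obtain ⟨i, -, rfl⟩ := hζ.eq_pow_of_pow_eq_one hw
    rw [map_pow, hσζ]
  obtain ⟨a, ha0, ha⟩ : ∃ a, a ≠ 0 ∧ σ a = ζ * a := by
    obtain ⟨c, hc⟩ := σ.exists_sum_mul_pow_apply_ne_zero (fun i ↦ ζ⁻¹ ^ i)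
      (by rw [hord]; exact hq.pos) (by simp)
    rw [hord] at hc
    refine ⟨_, hc, ?_⟩
    rw [map_sum, ← sum_range_succ_shift (fun i ↦ ζ⁻¹ ^ i * (σ ^ i) c) q
      (by simp [hpow, hζ.pow_eq_one]), mul_sum]
    refine sum_congr rfl fun i _ ↦ ?_
    rw [map_mul, map_pow, map_inv₀, hσζ, AlgEquiv.apply_pow_apply, pow_succ ζ⁻¹]
    linear_combination (-(ζ⁻¹ ^ i * (σ ^ (i + 1)) c)) * mul_inv_cancel₀ hζ0
  obtain ⟨b, hb⟩ := exists_pow_nat_eq a q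
  have hb0 : b ≠ 0 := by rintro rfl; exact ha0 (by rw [← hb, zero_pow hq.ne_zero])
  obtain ⟨ε, hε⟩ : ∃ ε, σ b = ε * b := ⟨σ b / b, by field_simp⟩
  have hεq : ε ^ q = ζ := by
    have : ε ^ q * a = ζ * a := by rw [← ha, ← hb, map_pow, hε, mul_pow]
    exact mul_right_cancel₀ ha0 this
  have hε0 : ε ≠ 0 := by rintro rfl; exact hζ0 (by rw [← hεq, zero_pow hq.ne_zero])
  obtain ⟨w, hw⟩ : ∃ w, σ ε = w * ε := ⟨σ ε / ε, by field_simp⟩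
  have hwq : w ^ q = 1 := by
    have : w ^ q * ε ^ q = 1 * ε ^ q := by rw [← mul_pow, ← hw, ← map_pow, hεq, hσζ, one_mul]
    exact mul_right_cancel₀ (pow_ne_zero _ hε0) this
  have hσw : σ w = w := hroots w hwq
  have hiter (i : ℕ) : (σ ^ i) b = w ^ (∑ j ∈ range i, j) * ε ^ i * b := by
    induction i with
    | zero => simp
    | succ i ih =>
      rw [← AlgEquiv.apply_pow_apply, ih, sum_range_succ]
      simp only [map_mul, map_pow, hσw, hw, hε]
      ring
  have hone : w ^ (∑ j ∈ range q, j) * ζ = 1 := by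
    have := hiter q
    rw [hpow, AlgEquiv.one_apply, hεq] at this
    exact mul_right_cancel₀ hb0 (by rw [one_mul, ← this])
  have hq2 : q = 2 := by
    by_contra h
    obtain ⟨r, hr⟩ := hq.odd_of_ne_two h
    have hs : ∑ j ∈ range q, j = q * r := by
      have := sum_range_id_mul_two q
      have h2 : q - 1 = r * 2 := by omega
      rw [h2, ← mul_assoc] at this
      exact Nat.eq_of_mul_eq_mul_right two_pos this
    rw [hs, pow_mul, hwq, one_pow, one_mul] at hone
    exact hζ.ne_one hq.one_lt hone
  subst hq2
  have hζ1 : ζ = -1 := hζ.eq_neg_one_of_two_right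
  refine ⟨rfl, ε, hεq.trans hζ1, fun h ↦ hqC ?_⟩
  have hw1 : w = 1 := mul_right_cancel₀ hε0 (by rw [← hw, h, one_mul])
  rw [hw1, hζ1, one_pow, one_mul] at hone
  push_cast
  linear_combination -hone

/-- **Artin–Schreier.** Every nontrivial element of finite order in the absolute Galois
group `Gal(F_sep/F)` of a field `F` has order exactly `2`. -/
theorem absoluteGaloisGroup_orderOf_eq_two (F : Type*) [Field F]
    (σ : SeparableClosure F ≃ₐ[F] SeparableClosure F)
    (hσ : σ ≠ 1) (hfin : IsOfFinOrder σ) : orderOf σ = 2 := by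
  have hpos : 0 < orderOf σ := hfin.orderOf_pos
  have order_pow (d m : ℕ) (h : orderOf σ = d * m) : orderOf (σ ^ m) = d := by
    have hm : 0 < m := Nat.pos_of_ne_zero fun h0 ↦ by simp [h, h0] at hpos
    rw [orderOf_pow_of_dvd hm.ne' (h ▸ dvd_mul_left m d), h, Nat.mul_div_cancel _ hm]
  have hprime (q : ℕ) (hq : q.Prime) (hdvd : q ∣ orderOf σ) : q = 2 := by
    have : Fact q.Prime := ⟨hq⟩
    obtain ⟨m, hm⟩ := hdvd
    exact (IsSepClosed.eq_two_of_orderOf_prime q (σ ^ m) (order_pow q m hm)).1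
  have htwo : 2 ∣ orderOf σ := by
    have h1 : orderOf σ ≠ 1 := by rwa [Ne, orderOf_eq_one_iff]
    exact hprime _ (Nat.minFac_prime h1) (Nat.minFac_dvd _) ▸ Nat.minFac_dvd _
  have hfour : ¬ 4 ∣ orderOf σ := by
    rintro ⟨m, hm⟩
    obtain ⟨-, ε, hε, hne⟩ := IsSepClosed.eq_two_of_orderOf_prime 2 (σ ^ (m * 2))
      (order_pow 2 (m * 2) (by omega))
    rw [pow_mul, pow_two, AlgEquiv.mul_apply] at hne
    have h2 : ((σ ^ m) ε) ^ 2 = ε ^ 2 := by rw [← map_pow, hε, map_neg, map_one]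
    rcases sq_eq_sq_iff_eq_or_eq_neg.1 h2 with h | h
    · exact hne (by rw [h, h])
    · exact hne (by rw [h, map_neg, h, neg_neg])
  obtain ⟨m, hm⟩ := htwo
  have hm1 : m = 1 := by
    by_contra h
    have h2 := hprime _ (Nat.minFac_prime h) ((Nat.minFac_dvd m).trans ⟨2, by omega⟩)
    have := h2 ▸ Nat.minFac_dvd m
    exact hfour (by omega)
  omega
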